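/- Let λ be a partition of n with N parts and dual partition λ' with N' = λ₁ parts, and write P_λ(x) = x^{d(λ)}(x−1)^{e(λ)}R_λ(x) with R_λ(0) ≠ 0 and R_λ(1) ≠ 0. Then deg R_λ = Σ_{i=1}^{N'−1} λ'_i λ'_{i+1} − Σ_{i=2}^{N'} C(λ'_i + 1, 2), where C(a,2) = a(a−1)/2. -/

import Mathlib

open Polynomial

/-- `f` represents the partition `λ₁ ≥ λ₂ ≥ … ≥ λ_N > 0` of `n`:
`f i = λᵢ` for `1 ≤ i ≤ N` and `f i = 0` for `i > N`. -/
def IsPartitionFun (f : ℕ → ℕ) (n N : ℕ) : Prop :=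
  (∀ i j, i ≤ j → f j ≤ f i) ∧ (∀ i, 1 ≤ i → (0 < f i ↔ i ≤ N)) ∧
    ∑ i ∈ Finset.Icc 1 N, f i = n

/-- `A` is strictly upper triangular: `A i j = 0` whenever `j ≤ i`. -/
def StrictUpper {m : ℕ} {F : Type*} [Zero F] (A : Matrix (Fin m) (Fin m) F) : Prop :=
  ∀ i j : Fin m, (j : ℕ) ≤ (i : ℕ) → A i j = 0

/-- `A` has Jordan type `λ`: `rank (A ^ k) = Σᵢ max (λᵢ - k) 0` for every `k ≥ 0`. -/
def HasJordanType {m : ℕ} {F : Type*} [Field F] (A : Matrix (Fin m) (Fin m) F)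
    (f : ℕ → ℕ) (N : ℕ) : Prop :=
  ∀ k : ℕ, (A ^ k).rank = ∑ i ∈ Finset.Icc 1 N, (f i - k)

/-- The number of strictly upper triangular `m × m` matrices over `F` of Jordan type `λ`. -/
noncomputable def jordanCount (m : ℕ) (f : ℕ → ℕ) (N : ℕ)
    (F : Type) [Field F] [Fintype F] : ℕ :=
  Nat.card {A : Matrix (Fin m) (Fin m) F // StrictUpper A ∧ HasJordanType A f N}

/-- `dualPart f N j = λ'_j`, the number of parts of `λ` that are `≥ j`. -/
def dualPart (f : ℕ → ℕ) (N j : ℕ) : ℕ :=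
  ((Finset.Icc 1 N).filter fun i => j ≤ f i).card

/-- `alphaCount f N k = α_k`, the number of parts of `λ` equal to `k`. -/
def alphaCount (f : ℕ → ℕ) (N k : ℕ) : ℕ :=
  ((Finset.Icc 1 N).filter fun i => f i = k).card

/-- The rows containing a removable cell of the Young diagram of `λ`:
rows `1 ≤ i ≤ N` with `i = N` or `λ_{i+1} < λᵢ` (for `i = N` the condition
`f (i+1) < f i` holds automatically since `f (N+1) = 0 < f N`). -/
def removables (f : ℕ → ℕ) (N : ℕ) : Finset ℕ :=
  (Finset.Icc 1 N).filter fun i => f (i + 1) < f i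

section LinearAlgebra

open Matrix Module

variable {F : Type} [Field F] {n : ℕ}

/-- The vectors `v` with `A ^ k *ᵥ v` in the range of `A ^ (k + 1)`. -/
def imageFiltration (A : Matrix (Fin n) (Fin n) F) (k : ℕ) : Submodule F (Fin n → F) :=
  (LinearMap.range (A ^ (k + 1)).mulVecLin).comap (A ^ k).mulVecLin

theorem mem_imageFiltration {A : Matrix (Fin n) (Fin n) F} {k : ℕ} {v : Fin n → F} :
    v ∈ imageFiltration A k ↔ ∃ w, A ^ (k + 1) *ᵥ w = A ^ k *ᵥ v := by
  simp [imageFiltration]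

theorem imageFiltration_mono (A : Matrix (Fin n) (Fin n) F) : Monotone (imageFiltration A) := by
  refine monotone_nat_of_le_succ fun k v hv => ?_
  rw [mem_imageFiltration] at hv ⊢
  obtain ⟨w, hw⟩ := hv
  refine ⟨w, ?_⟩
  rw [pow_succ' A (k + 1), ← mulVec_mulVec, hw, mulVec_mulVec, pow_succ' A k]

theorem range_pow_succ_le (A : Matrix (Fin n) (Fin n) F) (k : ℕ) :
    LinearMap.range (A ^ (k + 1)).mulVecLin ≤ LinearMap.range (A ^ k).mulVecLin := by
  rw [pow_succ, mulVecLin_mul]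
  exact LinearMap.range_comp_le_range _ _

theorem rank_pow_succ_le (A : Matrix (Fin n) (Fin n) F) (k : ℕ) :
    (A ^ (k + 1)).rank ≤ (A ^ k).rank :=
  Submodule.finrank_mono (range_pow_succ_le A k)

theorem finrank_imageFiltration_add (A : Matrix (Fin n) (Fin n) F) (k : ℕ) :
    finrank F (imageFiltration A k) + (A ^ k).rank = n + (A ^ (k + 1)).rank := by
  set g := (A ^ k).mulVecLin with hg
  have h1 := (g.domRestrict (imageFiltration A k)).finrank_range_add_finrank_ker
  have h2 := g.finrank_range_add_finrank_ker
  have hr : LinearMap.range (g.domRestrict (imageFiltration A k)) =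
      LinearMap.range (A ^ (k + 1)).mulVecLin := by
    rw [LinearMap.range_domRestrict, imageFiltration, Submodule.map_comap_eq,
      inf_eq_right.2 (range_pow_succ_le A k)]
  have hk : finrank F (LinearMap.ker (g.domRestrict (imageFiltration A k))) =
      finrank F (LinearMap.ker g) := by
    rw [LinearMap.ker_domRestrict]
    exact (Submodule.comapSubtypeEquivOfLe (LinearMap.ker_le_comap g)).finrank_eq
  rw [hr, hk] at h1
  rw [finrank_fin_fun] at h2
  change finrank F (imageFiltration A k) + finrank F (LinearMap.range g) =
    n + finrank F (LinearMap.range (A ^ (k + 1)).mulVecLin)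
  omega

/-- The matrix `A` with the column `v` and then a zero row appended. -/
def appendColumn (A : Matrix (Fin n) (Fin n) F) (v : Fin n → F) :
    Matrix (Fin (n + 1)) (Fin (n + 1)) F :=
  reindexAlgEquiv F F finSumFinEquiv (fromBlocks A (replicateCol (Fin 1) v) 0 0)

theorem appendColumn_pow_succ (A : Matrix (Fin n) (Fin n) F) (v : Fin n → F) (k : ℕ) :
    appendColumn A v ^ (k + 1) = reindexAlgEquiv F F finSumFinEquiv
      (fromBlocks (A ^ (k + 1)) (replicateCol (Fin 1) (A ^ k *ᵥ v)) 0 0) := by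
  rw [appendColumn, ← map_pow]
  congr 1
  induction k with
  | zero => simp
  | succ k ih =>
    rw [pow_succ', ih, fromBlocks_multiply, pow_succ' A (k + 1)]
    simp [← replicateCol_mulVec, mulVec_mulVec, ← pow_succ']

open Classical in
theorem rank_fromBlocks_replicateCol (A : Matrix (Fin n) (Fin n) F) (v : Fin n → F) :
    (fromBlocks A (replicateCol (Fin 1) v) 0 0 : Matrix (Fin n ⊕ Fin 1) (Fin n ⊕ Fin 1) F).rank =
      A.rank + if v ∈ LinearMap.range A.mulVecLin then 0 else 1 := by
  have hfac : (fromBlocks A (replicateCol (Fin 1) v) 0 0 :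
      Matrix (Fin n ⊕ Fin 1) (Fin n ⊕ Fin 1) F) =
      (fromRows 1 0 : Matrix (Fin n ⊕ Fin 1) (Fin n) F) *
        (fromCols A (replicateCol (Fin 1) v) : Matrix (Fin n) (Fin n ⊕ Fin 1) F) := by
    rw [fromRows_mul]
    ext i j
    rcases i with i | i <;> rcases j with j | j <;> simp
  have hinj : Function.Injective (fromRows 1 0 : Matrix (Fin n ⊕ Fin 1) (Fin n) F).mulVecLin := by
    intro x y h
    ext i
    simpa [fromRows_mulVec] using congrFun h (Sum.inl i)
  have hrange : LinearMap.range (fromCols A (replicateCol (Fin 1) v)).mulVecLin =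
      LinearMap.range A.mulVecLin ⊔ Submodule.span F {v} := by
    ext w
    simp only [LinearMap.mem_range, mulVecLin_apply, Submodule.mem_sup,
      Submodule.mem_span_singleton]
    constructor
    · rintro ⟨x, rfl⟩
      refine ⟨_, ⟨x ∘ Sum.inl, rfl⟩, _, ⟨x (Sum.inr 0), rfl⟩, ?_⟩
      ext i
      simp [mulVec, dotProduct, mul_comm]
    · rintro ⟨_, ⟨x, rfl⟩, _, ⟨a, rfl⟩, rfl⟩
      refine ⟨Sum.elim x fun _ => a, ?_⟩
      ext i
      simp [mulVec, dotProduct, mul_comm]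
  rw [hfac, rank, mulVecLin_mul, LinearMap.range_comp,
    ← (Submodule.equivMapOfInjective _ hinj _).finrank_eq, hrange]
  split_ifs with h
  · rw [sup_eq_left.2 ((Submodule.span_singleton_le_iff_mem _ _).2 h)]; rfl
  · exact Submodule.finrank_sup_span_singleton h

open Classical in
theorem rank_appendColumn_pow_succ (A : Matrix (Fin n) (Fin n) F) (v : Fin n → F) (k : ℕ) :
    (appendColumn A v ^ (k + 1)).rank =
      (A ^ (k + 1)).rank + if v ∈ imageFiltration A k then 0 else 1 := by
  rw [appendColumn_pow_succ, coe_reindexAlgEquiv, rank_reindex, rank_fromBlocks_replicateCol]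
  rfl

theorem strictUpper_appendColumn {A : Matrix (Fin n) (Fin n) F} {v : Fin n → F} :
    StrictUpper (appendColumn A v) ↔ StrictUpper A := by
  constructor
  · intro h i j hij
    have := h (finSumFinEquiv (Sum.inl i)) (finSumFinEquiv (Sum.inl j)) (by simpa using hij)
    simpa [appendColumn] using this
  · intro h i j hij
    obtain ⟨i, rfl⟩ := finSumFinEquiv.surjective i
    obtain ⟨j, rfl⟩ := finSumFinEquiv.surjective j
    rcases i with i | i <;> rcases j with j | j <;>
      simp [appendColumn] at hij ⊢
    · exact h i j hij
    · omega

/-- Strictly upper triangular matrices of size `n + 1` arise by appending a column. -/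
noncomputable def strictUpperSuccEquiv :
    {A : Matrix (Fin n) (Fin n) F // StrictUpper A} × (Fin n → F) ≃
      {B : Matrix (Fin (n + 1)) (Fin (n + 1)) F // StrictUpper B} :=
  Equiv.ofBijective (fun x => ⟨appendColumn x.1.1 x.2, strictUpper_appendColumn.2 x.1.2⟩) <| by
    constructor
    · rintro ⟨⟨A, hA⟩, v⟩ ⟨⟨A', hA'⟩, v'⟩ h
      have h' := (reindexAlgEquiv F F finSumFinEquiv).injective (Subtype.ext_iff.1 h)
      rw [fromBlocks_inj] at h'
      obtain ⟨rfl, h2, -⟩ := h'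
      rw [replicateCol_inj] at h2
      exact Prod.ext rfl h2
    · rintro ⟨B, hB⟩
      have hB' : appendColumn (fun i j => B i.castSucc j.castSucc)
          (fun i => B i.castSucc (Fin.last n)) = B := by
        ext i j
        obtain ⟨i, rfl⟩ := finSumFinEquiv.surjective i
        obtain ⟨j, rfl⟩ := finSumFinEquiv.surjective j
        rcases i with i | i <;> rcases j with j | j
        · simp [appendColumn]; rfl
        · have : j = 0 := Subsingleton.elim _ _
          subst this
          simp [appendColumn]; rfl
        · simp only [appendColumn, coe_reindexAlgEquiv, reindex_apply, submatrix_apply,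
            Equiv.symm_apply_apply]
          refine (hB _ _ ?_).symm
          simp
        · simp only [appendColumn, coe_reindexAlgEquiv, reindex_apply, submatrix_apply,
            Equiv.symm_apply_apply]
          refine (hB _ _ ?_).symm
          simp
      exact ⟨⟨⟨_, fun i j hij => hB i.castSucc j.castSucc hij⟩, _⟩, Subtype.ext hB'⟩

theorem StrictUpper.pow_eq_zero {A : Matrix (Fin n) (Fin n) F} (hA : StrictUpper A) :
    A ^ n = 0 := by
  induction n with
  | zero => exact Subsingleton.elim _ _
  | succ n ih =>
    obtain ⟨⟨A', v⟩, h⟩ := strictUpperSuccEquiv.surjective ⟨A, hA⟩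
    have h' : appendColumn A'.1 v = A := congrArg Subtype.val h
    rw [← h', appendColumn_pow_succ, pow_succ, ih A'.2]
    simp

/-- The Jordan type of the nilpotent matrix `A` has `c k` parts greater than `k`, for all `k`. -/
def HasColumns (A : Matrix (Fin n) (Fin n) F) (c : ℕ → ℕ) : Prop :=
  ∀ k, (A ^ k).rank = (A ^ (k + 1)).rank + c k

theorem HasColumns.finrank_imageFiltration {A : Matrix (Fin n) (Fin n) F} {c : ℕ → ℕ}
    (h : HasColumns A c) (k : ℕ) : finrank F (imageFiltration A k) + c k = n := by
  have h1 := finrank_imageFiltration_add A k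
  have h2 := h k
  omega

theorem HasColumns.antitone {A : Matrix (Fin n) (Fin n) F} {c : ℕ → ℕ}
    (h : HasColumns A c) : Antitone c := by
  intro k l hkl
  have h1 := h.finrank_imageFiltration k
  have h2 := h.finrank_imageFiltration l
  have h3 := Submodule.finrank_mono (imageFiltration_mono A hkl)
  omega

/-- `j` is the first step of the image filtration of `A` that contains `v`. -/
def IsFirstLevel (A : Matrix (Fin n) (Fin n) F) (v : Fin n → F) (j : ℕ) : Prop :=
  v ∈ imageFiltration A j ∧ ∀ k < j, v ∉ imageFiltration A k

theorem IsFirstLevel.unique {A : Matrix (Fin n) (Fin n) F} {v : Fin n → F} {i j : ℕ}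
    (hi : IsFirstLevel A v i) (hj : IsFirstLevel A v j) : i = j := by
  rcases lt_trichotomy i j with h | h | h
  · exact absurd hi.1 (hj.2 i h)
  · exact h
  · exact absurd hj.1 (hi.2 j h)

theorem StrictUpper.exists_isFirstLevel {A : Matrix (Fin n) (Fin n) F} (hA : StrictUpper A)
    (v : Fin n → F) : ∃ j ∈ Finset.range (n + 1), IsFirstLevel A v j := by
  classical
  have hn : v ∈ imageFiltration A n := by
    rw [mem_imageFiltration, hA.pow_eq_zero]
    exact ⟨0, by simp⟩
  have hex : ∃ k, v ∈ imageFiltration A k := ⟨n, hn⟩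
  exact ⟨Nat.find hex, Finset.mem_range.2 (Nat.lt_succ_of_le (Nat.find_min' hex hn)),
    Nat.find_spec hex, fun k hk => Nat.find_min hex hk⟩

theorem IsFirstLevel.rank_appendColumn_pow {A : Matrix (Fin n) (Fin n) F} {v : Fin n → F} {j : ℕ}
    (hj : IsFirstLevel A v j) (k : ℕ) :
    (appendColumn A v ^ k).rank = (A ^ k).rank + if k ≤ j then 1 else 0 := by
  classical
  cases k with
  | zero => simp
  | succ k =>
    rw [rank_appendColumn_pow_succ]
    by_cases h : k + 1 ≤ j
    · rw [if_neg (hj.2 k h), if_pos h]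
    · rw [if_pos (imageFiltration_mono A (by omega) hj.1), if_neg h]

theorem IsFirstLevel.hasColumns_appendColumn {A : Matrix (Fin n) (Fin n) F} {v : Fin n → F}
    {j : ℕ} (hj : IsFirstLevel A v j) {c : ℕ → ℕ} :
    HasColumns (appendColumn A v) c ↔
      0 < c j ∧ HasColumns A (Function.update c j (c j - 1)) := by
  simp only [HasColumns, hj.rank_appendColumn_pow]
  constructor
  · intro h
    have h0 : 0 < c j := by
      have h1 := h j
      have h2 := rank_pow_succ_le A j
      simp at h1
      omega
    refine ⟨h0, fun k => ?_⟩
    have h1 := h k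
    rcases lt_trichotomy k j with h | rfl | h
    · rw [Function.update_of_ne h.ne]
      rw [if_pos h.le, if_pos (by omega)] at h1
      omega
    · rw [Function.update_self]
      rw [if_pos le_rfl, if_neg (by omega)] at h1
      omega
    · rw [Function.update_of_ne h.ne']
      rw [if_neg (by omega), if_neg (by omega)] at h1
      omega
  · rintro ⟨h0, h⟩ k
    have h1 := h k
    rcases lt_trichotomy k j with h | rfl | h
    · rw [Function.update_of_ne h.ne] at h1
      rw [if_pos h.le, if_pos (by omega)]
      omega
    · rw [Function.update_self] at h1
      rw [if_pos le_rfl, if_neg (by omega)]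
      omega
    · rw [Function.update_of_ne h.ne'] at h1
      rw [if_neg (by omega), if_neg (by omega)]
      omega

variable (F) in
/-- The number of strictly upper triangular matrices with columns `c`. -/
noncomputable def columnCount (n : ℕ) (c : ℕ → ℕ) : ℕ :=
  Nat.card {A : {A : Matrix (Fin n) (Fin n) F // StrictUpper A} // HasColumns A.1 c}

/-- The number of ways to add the lowest cell of column `j` of the diagram with columns `c`,
which has `n + 1` cells. -/
def columnWeight (q : ℤ) (n : ℕ) (c : ℕ → ℕ) (j : ℕ) : ℤ :=
  q ^ (n + 1 - c j) - if j = 0 then 0 else q ^ (n - c (j - 1))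

open Classical in
theorem HasColumns.card_imageFiltration [Fintype F] {A : Matrix (Fin n) (Fin n) F} {c : ℕ → ℕ}
    (h : HasColumns A c) (k : ℕ) :
    (Finset.univ.filter fun v => v ∈ imageFiltration A k).card = Fintype.card F ^ (n - c k) := by
  rw [← Fintype.card_subtype]
  have h1 := h.finrank_imageFiltration k
  rw [← Nat.card_eq_fintype_card, ← Nat.card_eq_fintype_card]
  change Nat.card (imageFiltration A k) = _
  rw [Module.natCard_eq_pow_finrank (K := F)]
  congr 1
  omega

open Classical in
theorem HasColumns.card_isFirstLevel [Fintype F] {A : Matrix (Fin n) (Fin n) F} {c : ℕ → ℕ}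
    {j : ℕ} (h : HasColumns A (Function.update c j (c j - 1))) (hj : 0 < c j) :
    ((Finset.univ.filter fun v => IsFirstLevel A v j).card : ℤ) =
      columnWeight (Fintype.card F) n c j := by
  have h1 := h.card_imageFiltration j
  rw [Function.update_self, show n - (c j - 1) = n + 1 - c j by omega] at h1
  cases j with
  | zero => simpa [IsFirstLevel, columnWeight] using congrArg (Nat.cast (R := ℤ)) h1
  | succ j =>
    have h2 := h.card_imageFiltration j
    rw [Function.update_of_ne (by omega)] at h2
    have hset : (Finset.univ.filter fun v => IsFirstLevel A v (j + 1)) =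
        (Finset.univ.filter fun v => v ∈ imageFiltration A (j + 1)) \
          Finset.univ.filter fun v => v ∈ imageFiltration A j := by
      ext v
      simp only [Finset.mem_filter, Finset.mem_univ, true_and, Finset.mem_sdiff]
      exact ⟨fun hv => ⟨hv.1, hv.2 j (Nat.lt_succ_self j)⟩,
        fun hv => ⟨hv.1, fun k hk hk' =>
          hv.2 (imageFiltration_mono A (Nat.lt_succ_iff.1 hk) hk')⟩⟩
    have hsub : (Finset.univ.filter fun v => v ∈ imageFiltration A j) ⊆
        Finset.univ.filter fun v => v ∈ imageFiltration A (j + 1) := by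
      intro v
      simp only [Finset.mem_filter, Finset.mem_univ, true_and]
      exact fun hv => imageFiltration_mono A (Nat.le_succ j) hv
    rw [hset, Finset.cast_card_sdiff hsub, h1, h2]
    simp [columnWeight]

theorem columnCount_succ [Fintype F] (n : ℕ) (c : ℕ → ℕ) :
    (columnCount F (n + 1) c : ℤ) = ∑ j ∈ Finset.range (n + 1), if c (j + 1) < c j then
      columnCount F n (Function.update c j (c j - 1)) *
        columnWeight (Fintype.card F) n c j else 0 := by
  classical
  have hcount : ∀ (m : ℕ) (d : ℕ → ℕ), (columnCount F m d : ℤ) =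
      ∑ A : {A : Matrix (Fin m) (Fin m) F // StrictUpper A}, if HasColumns A.1 d then 1 else 0 := by
    intro m d
    rw [columnCount, Nat.card_eq_fintype_card, Fintype.card_subtype, Finset.sum_boole]
  have hlevel : ∀ (A : {A : Matrix (Fin n) (Fin n) F // StrictUpper A}) (v : Fin n → F),
      (if HasColumns (appendColumn A.1 v) c then 1 else 0 : ℤ) =
        ∑ j ∈ Finset.range (n + 1), if IsFirstLevel A.1 v j then
          if 0 < c j ∧ HasColumns A.1 (Function.update c j (c j - 1)) then 1 else 0 else 0 := by
    intro A v
    obtain ⟨j, hj, hjv⟩ := A.2.exists_isFirstLevel v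
    rw [Finset.sum_eq_single_of_mem j hj
      (fun i _ hij => if_neg fun hi => hij (hi.unique hjv)), if_pos hjv]
    simp only [hjv.hasColumns_appendColumn]
  rw [hcount, ← strictUpperSuccEquiv.sum_comp, Fintype.sum_prod_type]
  have h1 : ∀ (A : {A : Matrix (Fin n) (Fin n) F // StrictUpper A}) (v : Fin n → F),
      (strictUpperSuccEquiv (A, v)).1 = appendColumn A.1 v := fun _ _ => rfl
  simp only [h1, hlevel]
  rw [Finset.sum_congr rfl fun A _ => Finset.sum_comm, Finset.sum_comm]
  refine Finset.sum_congr rfl fun j _ => ?_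
  have h2 : ∀ A : {A : Matrix (Fin n) (Fin n) F // StrictUpper A},
      (∑ v, if IsFirstLevel A.1 v j then
        if 0 < c j ∧ HasColumns A.1 (Function.update c j (c j - 1)) then 1 else 0 else 0 : ℤ) =
      if c (j + 1) < c j then (if HasColumns A.1 (Function.update c j (c j - 1)) then 1 else 0) *
        columnWeight (Fintype.card F) n c j else 0 := by
    intro A
    by_cases hA : HasColumns A.1 (Function.update c j (c j - 1))
    · by_cases hj : 0 < c j
      · have h3 := hA.antitone (show j ≤ j + 1 by omega)
        rw [Function.update_of_ne (by omega), Function.update_self] at h3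
        simp only [hA, hj, and_self, if_true]
        rw [if_pos (by omega), Finset.sum_boole, hA.card_isFirstLevel hj, one_mul]
      · simp [hj, show ¬ c (j + 1) < c j by omega]
    · simp [hA]
  rw [Finset.sum_congr rfl fun A _ => h2 A]
  split_ifs
  · rw [hcount, Finset.sum_mul]
  · simp

theorem columnCount_zero [Fintype F] {c : ℕ → ℕ} (hc : ∀ k, c k = 0) : columnCount F 0 c = 1 := by
  rw [columnCount, Nat.card_eq_one_iff_unique]
  refine ⟨⟨fun A B => Subtype.ext (Subtype.ext (Subsingleton.elim _ _))⟩,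
    ⟨⟨⟨0, fun i => i.elim0⟩, fun k => ?_⟩⟩⟩
  rw [hc, Subsingleton.elim ((0 : Matrix (Fin 0) (Fin 0) F) ^ k) (0 ^ (k + 1)), add_zero]

end LinearAlgebra

/-- `c` is the sequence of column lengths of a Young diagram with `n` cells. -/
structure IsColumnSeq (n : ℕ) (c : ℕ → ℕ) : Prop where
  antitone : Antitone c
  eq_zero : c n = 0
  sum_eq : ∑ i ∈ Finset.range n, c i = n

theorem IsColumnSeq.removeCell {n : ℕ} {c : ℕ → ℕ} (hc : IsColumnSeq (n + 1) c) {j : ℕ}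
    (hj : c (j + 1) < c j) : IsColumnSeq n (Function.update c j (c j - 1)) := by
  have hjn : j < n + 1 := by
    by_contra h
    have := hc.antitone (not_lt.1 h)
    rw [hc.eq_zero] at this
    omega
  set c' := Function.update c j (c j - 1) with hc'
  have hne : ∀ i, i ≠ j → c' i = c i := fun i hi => Function.update_of_ne hi _ _
  have hj' : c' j = c j - 1 := Function.update_self _ _ _
  have ha : Antitone c' := by
    refine antitone_nat_of_succ_le fun i => ?_
    have h1 := hc.antitone (Nat.le_add_right i 1)
    by_cases h2 : i = j
    · subst h2
      rw [hj', hne _ (by omega)]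
      omega
    · rw [hne i h2]
      by_cases h3 : i + 1 = j
      · rw [h3, hj']
        rw [h3] at h1
        omega
      · rwa [hne _ h3]
  have hsum : ∑ i ∈ Finset.range (n + 1), c' i = n := by
    have h1 := hc.sum_eq
    rw [← Finset.sum_erase_add _ _ (Finset.mem_range.2 hjn)] at h1 ⊢
    have h2 : ∑ i ∈ (Finset.range (n + 1)).erase j, c' i =
        ∑ i ∈ (Finset.range (n + 1)).erase j, c i :=
      Finset.sum_congr rfl fun i hi => hne i (Finset.ne_of_mem_erase hi)
    omega
  have h0 : c' n = 0 := by
    by_contra h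
    have h1 : (Finset.range (n + 1)).card • 1 ≤ ∑ i ∈ Finset.range (n + 1), c' i :=
      Finset.card_nsmul_le_sum _ _ _ fun i hi => by
        have := ha (Nat.lt_succ_iff.1 (Finset.mem_range.1 hi))
        omega
    simp [hsum] at h1
  refine ⟨ha, h0, ?_⟩
  rwa [Finset.sum_range_succ, h0, add_zero] at hsum

theorem IsColumnSeq.exists_last {n : ℕ} {c : ℕ → ℕ} (hc : IsColumnSeq (n + 1) c) :
    ∃ j, c (j + 1) = 0 ∧ 0 < c j := by
  by_contra! h
  have h0 : ∀ k, c 0 ≠ 0 → c k ≠ 0 := by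
    intro k hk
    induction k with
    | zero => exact hk
    | succ k ih =>
      intro h1
      have := h k h1
      omega
  have h1 : c 0 = 0 := by
    by_contra h2
    exact h0 _ h2 hc.eq_zero
  have h2 := hc.sum_eq
  rw [Finset.sum_eq_zero fun i _ => Nat.le_zero.1 (h1 ▸ hc.antitone (Nat.zero_le i))] at h2
  omega

/-- The numerical relations between the column lengths `c` of a diagram with `n` cells, the
multiplicities `d`, `e` of the roots `0`, `1`, and the degree `r` of the cofactor,
where `d` exceeds its minimal value by `s`. -/
structure ExponentRelations (n : ℕ) (c : ℕ → ℕ) (s d e r : ℕ) : Prop where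
  zero_mult : d + (c 0).choose 2 + ∑ i ∈ Finset.range n, c i * c (i + 1) = n.choose 2 + s
  one_mult : e + c 0 = n
  degree : r + d + e + ∑ i ∈ Finset.range n, (c i).choose 2 = n.choose 2

/-- The properties of the cofactor that survive the recursion. -/
structure IsCofactor (r : ℕ) (R : ℤ[X]) : Prop where
  natDegree_le : R.natDegree ≤ r
  coeff_pos : 0 < R.coeff r
  eval_one_pos : 0 < R.eval 1
  eval_zero_pos : 0 < R.eval 0

theorem IsCofactor.mul {r s : ℕ} {R S : ℤ[X]} (hR : IsCofactor r R) (hS : IsCofactor s S) :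
    IsCofactor (r + s) (R * S) where
  natDegree_le := natDegree_mul_le_of_le hR.natDegree_le hS.natDegree_le
  coeff_pos := by
    rw [coeff_mul_add_eq_of_natDegree_le hR.natDegree_le hS.natDegree_le]
    exact mul_pos hR.coeff_pos hS.coeff_pos
  eval_one_pos := by
    rw [eval_mul]
    exact mul_pos hR.eval_one_pos hS.eval_one_pos
  eval_zero_pos := by
    rw [eval_mul]
    exact mul_pos hR.eval_zero_pos hS.eval_zero_pos

theorem isCofactor_one : IsCofactor 0 1 := ⟨by simp, by simp, by simp, by simp⟩

theorem isCofactor_geom_sum (r : ℕ) :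
    IsCofactor r (∑ i ∈ Finset.range (r + 1), (X : ℤ[X]) ^ i) where
  natDegree_le := natDegree_sum_le_of_forall_le _ _ fun i hi => by
    rw [natDegree_X_pow]
    exact Nat.lt_succ_iff.1 (Finset.mem_range.1 hi)
  coeff_pos := by simp [coeff_X_pow]
  eval_one_pos := by simp [eval_finsetSum]
  eval_zero_pos := by simp [eval_finsetSum, Finset.sum_range_succ']

theorem ExponentRelations.addCell {n : ℕ} {c : ℕ → ℕ} (hc : IsColumnSeq (n + 1) c) {j : ℕ}
    (hj : c (j + 1) < c j) {d e r : ℕ} {R : ℤ[X]}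
    (h : ExponentRelations n (Function.update c j (c j - 1)) 0 d e r) (hR : IsCofactor r R) :
    ∃ (d' e' r' : ℕ) (R' : ℤ[X]), ExponentRelations (n + 1) c (c (j + 1)) d' e' r' ∧
      IsCofactor r' R' ∧ ∀ q : ℤ, q ^ d * (q - 1) ^ e * R.eval q * columnWeight q n c j =
        q ^ d' * (q - 1) ^ e' * R'.eval q := by
  have hc' := hc.removeCell hj
  obtain ⟨h1, h2, h3⟩ := h
  set c' := Function.update c j (c j - 1) with hcc'
  have hjn : j < n + 1 := by
    by_contra h
    have := hc.antitone (not_lt.1 h)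
    rw [hc.eq_zero] at this
    omega
  have hne : ∀ i, i ≠ j → c' i = c i := fun i hi => Function.update_of_ne hi _ _
  have hj' : c' j = c j - 1 := Function.update_self _ _ _
  have hadd : ∀ i, c i = c' i + if i = j then 1 else 0 := by
    intro i
    split_ifs with hi
    · rw [hi, hj']; omega
    · rw [hne i hi, add_zero]
  have hchoose : ∑ i ∈ Finset.range (n + 1), (c i).choose 2 =
      ∑ i ∈ Finset.range n, (c' i).choose 2 + (c j - 1) := by
    have hpt : ∀ i, (c i).choose 2 = (c' i).choose 2 + if i = j then c j - 1 else 0 := by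
      intro i
      split_ifs with hi
      · rw [hi, hadd j, if_pos rfl, Nat.choose_succ_succ' (c' j) 1]
        simp [add_comm]
      · rw [hne i hi, add_zero]
    rw [Finset.sum_congr rfl fun i _ => hpt i, Finset.sum_add_distrib, Finset.sum_ite_eq',
      if_pos (Finset.mem_range.2 hjn), Finset.sum_range_succ, hc'.eq_zero]
    simp
  have hprod : ∑ i ∈ Finset.range (n + 1), c i * c (i + 1) =
      ∑ i ∈ Finset.range n, c' i * c' (i + 1) + c (j + 1) + if j = 0 then 0 else c (j - 1) := by
    have hpt : ∀ i, c i * c (i + 1) = c' i * c' (i + 1) + (if i = j then c (j + 1) else 0) +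
        if i + 1 = j then c (j - 1) else 0 := by
      intro i
      rcases eq_or_ne i j with rfl | hi
      · rw [hadd i, hne (i + 1) (by omega)]
        simp
        ring
      · rcases eq_or_ne (i + 1) j with rfl | hi'
        · rw [hadd (i + 1), hne i hi]
          simp
          ring
        · rw [hne i hi, hne _ hi', if_neg hi, if_neg hi']
          ring
    rw [Finset.sum_congr rfl fun i _ => hpt i, Finset.sum_add_distrib, Finset.sum_add_distrib,
      Finset.sum_ite_eq', if_pos (Finset.mem_range.2 hjn), Finset.sum_range_succ, hc'.eq_zero]
    cases j with
    | zero => simp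
    | succ j => simp [show j < n + 1 by omega]
  have hn : (n + 1).choose 2 = n.choose 2 + n := by
    rw [Nat.choose_succ_succ' n 1]
    simp [add_comm]
  cases j with
  | zero =>
    have h0 : (c 0).choose 2 = (c' 0).choose 2 + (c 0 - 1) := by
      rw [hadd 0, if_pos rfl, Nat.choose_succ_succ' (c' 0) 1]
      simp [add_comm]
    have hle : c 0 ≤ n + 1 := by omega
    refine ⟨d + (n + 1 - c 0), e, r, R, ⟨?_, ?_, ?_⟩, hR, fun q => ?_⟩
    · rw [if_pos rfl] at hprod
      omega
    · omega
    · omega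
    · simp only [columnWeight, if_true]
      ring
  | succ j =>
    have h0 : c' 0 = c 0 := hne 0 (by omega)
    rw [h0] at h1 h2
    have hle : c j ≤ n := by
      rw [← hne j (by omega)]
      have := hc'.antitone (Nat.zero_le j)
      omega
    have hmono := hc.antitone (Nat.le_add_right j 1)
    refine ⟨d + (n - c j), e + 1, r + (c j - c (j + 1)), _, ⟨?_, ?_, ?_⟩,
      hR.mul (isCofactor_geom_sum _), fun q => ?_⟩
    · rw [if_neg (by omega), Nat.add_sub_cancel] at hprod
      omega
    · omega
    · omega
    · have hgeom := geom_sum_mul q (c j - c (j + 1) + 1)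
      have hpow : q ^ (n + 1 - c (j + 1)) = q ^ (n - c j) * q ^ (c j - c (j + 1) + 1) := by
        rw [← pow_add]
        congr 1
        omega
      simp only [columnWeight, Nat.add_sub_cancel, eval_mul, eval_finsetSum, eval_pow, eval_X,
        if_neg (Nat.succ_ne_zero j)]
      rw [hpow, eq_add_of_sub_eq hgeom.symm]
      ring

theorem exists_columnCount_eq (n : ℕ) (c : ℕ → ℕ) (hc : IsColumnSeq n c) :
    ∃ (d e r : ℕ) (R : ℤ[X]), ExponentRelations n c 0 d e r ∧ IsCofactor r R ∧
      ∀ (F : Type) [Field F] [Fintype F], (columnCount F n c : ℤ) =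
        (Fintype.card F : ℤ) ^ d * ((Fintype.card F : ℤ) - 1) ^ e *
          R.eval (Fintype.card F : ℤ) := by
  induction n generalizing c with
  | zero =>
    have h0 : ∀ k, c k = 0 := fun k => Nat.le_zero.1 (hc.eq_zero ▸ hc.antitone (Nat.zero_le k))
    refine ⟨0, 0, 0, 1, ⟨?_, ?_, ?_⟩, isCofactor_one, fun F _ _ => ?_⟩
    · simp [h0]
    · simp [h0]
    · simp
    · simp [columnCount_zero h0]
  | succ n ih =>
    have hstep : ∀ j, ∃ (d e r : ℕ) (R : ℤ[X]), c (j + 1) < c j →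
        ExponentRelations (n + 1) c (c (j + 1)) d e r ∧ IsCofactor r R ∧
        ∀ (F : Type) [Field F] [Fintype F],
          (columnCount F n (Function.update c j (c j - 1)) : ℤ) *
            columnWeight (Fintype.card F) n c j =
          (Fintype.card F : ℤ) ^ d * ((Fintype.card F : ℤ) - 1) ^ e *
            R.eval (Fintype.card F : ℤ) := by
      intro j
      by_cases hj : c (j + 1) < c j
      · obtain ⟨d, e, r, R, h, hR, hF⟩ := ih _ (hc.removeCell hj)
        obtain ⟨d', e', r', R', h', hR', hq⟩ := h.addCell hc hj hR
        exact ⟨d', e', r', R', fun _ => ⟨h', hR', fun F _ _ => by rw [hF, hq]⟩⟩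
      · exact ⟨0, 0, 0, 0, fun h => absurd h hj⟩
    choose d e r R hall using hstep
    obtain ⟨k, hk0, hk⟩ := hc.exists_last
    have hkJ : c (k + 1) < c k := by omega
    have hkn : k < n + 1 := by
      by_contra h
      have := hc.antitone (not_lt.1 h)
      rw [hc.eq_zero] at this
      omega
    obtain ⟨hkE, hkR, -⟩ := hall k hkJ
    rw [hk0] at hkE
    have hd : ∀ j, c (j + 1) < c j → d j = d k + c (j + 1) := fun j hj => by
      have h1 := (hall j hj).1.zero_mult
      have h2 := hkE.zero_mult
      omega
    have he : ∀ j, c (j + 1) < c j → e j = e k := fun j hj => by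
      have h1 := (hall j hj).1.one_mult
      have h2 := hkE.one_mult
      omega
    have hr : ∀ j, c (j + 1) < c j → c (j + 1) + r j = r k := fun j hj => by
      have h1 := (hall j hj).1.degree
      have h2 := hkE.degree
      have h3 := hd j hj
      have h4 := he j hj
      omega
    set J := (Finset.range (n + 1)).filter fun j => c (j + 1) < c j with hJ
    have hmem : ∀ {j}, j ∈ J → c (j + 1) < c j := fun hj => (Finset.mem_filter.1 hj).2
    have hkmem : k ∈ J := Finset.mem_filter.2 ⟨Finset.mem_range.2 hkn, hkJ⟩
    refine ⟨d k, e k, r k, ∑ j ∈ J, X ^ c (j + 1) * R j, hkE, ⟨?_, ?_, ?_, ?_⟩,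
      fun F _ _ => ?_⟩
    · refine natDegree_sum_le_of_forall_le _ _ fun j hj => ?_
      rw [← hr j (hmem hj)]
      exact natDegree_mul_le_of_le (natDegree_X_pow_le _) (hall j (hmem hj)).2.1.natDegree_le
    · rw [finsetSum_coeff]
      refine Finset.sum_pos (fun j hj => ?_) ⟨k, hkmem⟩
      rw [← hr j (hmem hj), add_comm (c (j + 1)), coeff_X_pow_mul]
      exact (hall j (hmem hj)).2.1.coeff_pos
    · rw [eval_finsetSum]
      refine Finset.sum_pos (fun j hj => ?_) ⟨k, hkmem⟩
      simpa using (hall j (hmem hj)).2.1.eval_one_pos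
    · rw [eval_finsetSum]
      refine Finset.sum_pos' (fun j hj => ?_) ⟨k, hkmem, ?_⟩
      · rw [eval_mul, eval_pow, eval_X]
        exact mul_nonneg (by positivity) (hall j (hmem hj)).2.1.eval_zero_pos.le
      · simpa [hk0] using hkR.eval_zero_pos
    · rw [columnCount_succ, ← Finset.sum_filter, ← hJ, eval_finsetSum, Finset.mul_sum]
      refine Finset.sum_congr rfl fun j hj => ?_
      rw [(hall j (hmem hj)).2.2 F, hd j (hmem hj), he j (hmem hj), eval_mul, eval_pow, eval_X]
      ring

theorem sum_sub_eq_add_dualPart (f : ℕ → ℕ) (N k : ℕ) :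
    ∑ i ∈ Finset.Icc 1 N, (f i - k) =
      ∑ i ∈ Finset.Icc 1 N, (f i - (k + 1)) + dualPart f N (k + 1) := by
  rw [dualPart, Finset.card_filter, ← Finset.sum_add_distrib]
  refine Finset.sum_congr rfl fun i _ => ?_
  split_ifs <;> omega

theorem IsPartitionFun.eq_zero_of_lt {f : ℕ → ℕ} {n N i : ℕ} (hf : IsPartitionFun f n N)
    (hi : N < i) : f i = 0 := by
  have := hf.2.1 i (by omega)
  omega

theorem IsPartitionFun.first_le {f : ℕ → ℕ} {n N : ℕ} (hf : IsPartitionFun f n N) : f 1 ≤ n := by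
  rcases Nat.eq_zero_or_pos N with rfl | hN
  · simp [hf.eq_zero_of_lt Nat.zero_lt_one]
  · rw [← hf.2.2]
    exact Finset.single_le_sum (fun _ _ => Nat.zero_le _) (Finset.mem_Icc.2 ⟨le_rfl, hN⟩)

theorem IsPartitionFun.dualPart_eq_zero {f : ℕ → ℕ} {n N j : ℕ} (hf : IsPartitionFun f n N)
    (hj : f 1 < j) : dualPart f N j = 0 := by
  rw [dualPart, Finset.card_eq_zero, Finset.filter_eq_empty_iff]
  intro i hi
  have := hf.1 1 i (Finset.mem_Icc.1 hi).1
  omega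

theorem IsPartitionFun.isColumnSeq {f : ℕ → ℕ} {n N : ℕ} (hf : IsPartitionFun f n N) :
    IsColumnSeq n fun k => dualPart f N (k + 1) where
  antitone := by
    intro k l hkl
    refine Finset.card_le_card fun i hi => ?_
    rw [Finset.mem_filter] at hi ⊢
    exact ⟨hi.1, by omega⟩
  eq_zero := hf.dualPart_eq_zero (Nat.lt_succ_of_le hf.first_le)
  sum_eq := by
    have h : ∀ m, ∑ k ∈ Finset.range m, dualPart f N (k + 1) +
        ∑ i ∈ Finset.Icc 1 N, (f i - m) = n := by
      intro m
      induction m with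
      | zero => simpa using hf.2.2
      | succ m ih =>
        rw [Finset.sum_range_succ]
        rw [sum_sub_eq_add_dualPart] at ih
        omega
    have h0 : ∑ i ∈ Finset.Icc 1 N, (f i - n) = 0 := Finset.sum_eq_zero fun i hi => by
      have h1 := hf.1 1 i (Finset.mem_Icc.1 hi).1
      have h2 := hf.first_le
      omega
    have := h n
    omega

theorem IsPartitionFun.hasJordanType_iff {f : ℕ → ℕ} {n N : ℕ} (hf : IsPartitionFun f n N)
    {F : Type} [Field F] (A : Matrix (Fin n) (Fin n) F) :
    HasJordanType A f N ↔ HasColumns A fun k => dualPart f N (k + 1) := by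
  constructor
  · intro h k
    rw [h k, h (k + 1), sum_sub_eq_add_dualPart]
  · intro h k
    induction k with
    | zero => simp [hf.2.2]
    | succ k ih =>
      have h1 := h k
      rw [ih, sum_sub_eq_add_dualPart] at h1
      exact (Nat.add_right_cancel h1).symm

theorem IsPartitionFun.jordanCount_eq {f : ℕ → ℕ} {n N : ℕ} (hf : IsPartitionFun f n N)
    (F : Type) [Field F] [Fintype F] :
    jordanCount n f N F = columnCount F n fun k => dualPart f N (k + 1) := by
  simp only [jordanCount, columnCount, hf.hasJordanType_iff]
  exact Nat.card_congr (Equiv.subtypeSubtypeEquivSubtypeInter _ _).symm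

theorem pow_mul_cancel_of_not_isRoot {a : ℤ} {m k : ℕ} {p q : ℤ[X]} (hp : ¬ p.IsRoot a)
    (hq : ¬ q.IsRoot a) (h : (X - C a) ^ m * p = (X - C a) ^ k * q) : p = q := by
  have hX : (X - C a : ℤ[X]) ≠ 0 := X_sub_C_ne_zero a
  have key : ∀ (s : ℤ[X]) (l : ℕ), ¬ s.IsRoot a → rootMultiplicity a ((X - C a) ^ l * s) = l := by
    intro s l hs
    have hs0 : s ≠ 0 := by
      rintro rfl
      exact hs (by simp)
    rw [rootMultiplicity_mul (mul_ne_zero (pow_ne_zero _ hX) hs0), rootMultiplicity_X_sub_C_pow,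
      rootMultiplicity_eq_zero hs, add_zero]
  have hmk : m = k := by rw [← key p m hp, h, key q k hq]
  subst hmk
  exact mul_left_cancel₀ (pow_ne_zero _ hX) h

theorem eq_of_X_pow_mul_X_sub_one_pow_mul_eq {d e d' e' : ℕ} {R S : ℤ[X]}
    (hR0 : R.eval 0 ≠ 0) (hR1 : R.eval 1 ≠ 0) (hS0 : S.eval 0 ≠ 0) (hS1 : S.eval 1 ≠ 0)
    (h : X ^ d * (X - 1) ^ e * R = X ^ d' * (X - 1) ^ e' * S) : R = S := by
  have h1 : (X - 1) ^ e * R = (X - 1) ^ e' * S := by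
    refine pow_mul_cancel_of_not_isRoot (a := 0) (m := d) (k := d') ?_ ?_ ?_
    · simpa [IsRoot.def] using hR0
    · simpa [IsRoot.def] using hS0
    · simpa [mul_assoc] using h
  exact pow_mul_cancel_of_not_isRoot (a := 1) (m := e) (k := e') hR1 hS1 (by simpa using h1)

theorem ExponentRelations.degree_eq {n l : ℕ} {c : ℕ → ℕ} {d e r : ℕ} (hc : IsColumnSeq n c)
    (h : ExponentRelations n c 0 d e r) (hl : l ≤ n) (hcl : ∀ k, l ≤ k → c k = 0) :
    (r : ℤ) = ∑ i ∈ Finset.Icc 1 (l - 1), (c (i - 1) : ℤ) * c i -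
      ∑ i ∈ Finset.Icc 2 l, ((c (i - 1) + 1).choose 2 : ℤ) := by
  have hsub : Finset.range l ⊆ Finset.range n := Finset.range_subset_range.2 hl
  have hprod : ∑ i ∈ Finset.Icc 1 (l - 1), (c (i - 1) : ℤ) * c i =
      ∑ i ∈ Finset.range n, (c i : ℤ) * c (i + 1) := by
    have h1 : ∑ i ∈ Finset.range (l - 1), (c i : ℤ) * c (i + 1) =
        ∑ i ∈ Finset.range n, (c i : ℤ) * c (i + 1) :=
      Finset.sum_subset (Finset.range_subset_range.2 (by omega)) fun i _ hi => by
        rw [hcl (i + 1) (by simp at hi; omega)]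
        simp
    rw [← h1]
    refine Finset.sum_nbij' (· - 1) (· + 1) ?_ ?_ ?_ ?_ fun i hi => ?_
    · intro i hi
      simp at hi ⊢
      omega
    · intro i hi
      simp at hi ⊢
      omega
    · intro i hi
      exact Nat.sub_add_cancel (Finset.mem_Icc.1 hi).1
    · intro i _
      exact Nat.add_sub_cancel i 1
    · rw [Nat.sub_add_cancel (Finset.mem_Icc.1 hi).1]
  have hchoose : ∑ i ∈ Finset.Icc 2 l, ((c (i - 1) + 1).choose 2 : ℤ) + (c 0 + 1).choose 2 =
      ∑ i ∈ Finset.range n, ((c i + 1).choose 2 : ℤ) := by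
    have h1 : ∑ i ∈ Finset.range l, ((c i + 1).choose 2 : ℤ) =
        ∑ i ∈ Finset.range n, ((c i + 1).choose 2 : ℤ) :=
      Finset.sum_subset hsub fun i _ hi => by
        rw [hcl i (by simpa using hi)]
        simp
    rw [← h1]
    cases l with
    | zero => simp [hcl 0 le_rfl]
    | succ l =>
      rw [Finset.sum_range_succ']
      congr 1
      refine Finset.sum_nbij' (· - 2) (· + 2) ?_ ?_ ?_ ?_ fun i hi => ?_
      · intro i hi
        simp at hi ⊢
        omega
      · intro i hi
        simp at hi ⊢
        omega
      · intro i hi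
        exact Nat.sub_add_cancel (Finset.mem_Icc.1 hi).1
      · intro i _
        exact Nat.add_sub_cancel i 2
      · rw [show i - 2 + 1 = i - 1 by have := (Finset.mem_Icc.1 hi).1; omega]
  have hsucc : ∀ a : ℕ, ((a + 1).choose 2 : ℤ) = a.choose 2 + a := by
    intro a
    rw [Nat.choose_succ_succ' a 1]
    push_cast
    simp [add_comm]
  have hsum : ∑ i ∈ Finset.range n, (c i : ℤ) = n := by exact_mod_cast hc.sum_eq
  simp only [hsucc, Finset.sum_add_distrib] at hchoose ⊢
  have h1 : (d : ℤ) + (c 0).choose 2 + ∑ i ∈ Finset.range n, (c i : ℤ) * c (i + 1) =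
      n.choose 2 := by exact_mod_cast h.zero_mult
  have h2 : (e : ℤ) + c 0 = n := by exact_mod_cast h.one_mult
  have h3 : (r : ℤ) + d + e + ∑ i ∈ Finset.range n, ((c i).choose 2 : ℤ) = n.choose 2 := by
    exact_mod_cast h.degree
  linarith

theorem deg_R (n N : ℕ) (f : ℕ → ℕ) (hf : IsPartitionFun f n N)
    (P : Polynomial ℤ)
    (hP : ∀ (F : Type) [Field F] [Fintype F],
      (jordanCount n f N F : ℤ) = P.eval (Fintype.card F : ℤ))
    (d e : ℕ) (R : Polynomial ℤ)
    (hfac : P = X ^ d * (X - 1) ^ e * R)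
    (hR0 : R.eval 0 ≠ 0) (hR1 : R.eval 1 ≠ 0) :
    (R.natDegree : ℤ) =
      ∑ i ∈ Finset.Icc 1 (f 1 - 1), (dualPart f N i : ℤ) * (dualPart f N (i + 1) : ℤ) -
      ∑ i ∈ Finset.Icc 2 (f 1), ((dualPart f N i + 1).choose 2 : ℤ) := by
  obtain ⟨d', e', r, S, hE, hS, hF⟩ := exists_columnCount_eq n _ hf.isColumnSeq
  have hPS : P = X ^ d' * (X - 1) ^ e' * S := by
    refine eq_of_infinite_eval_eq _ _ ?_
    refine (Nat.infinite_setOfPred_prime.image Nat.cast_injective.injOn).mono ?_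
    rintro _ ⟨p, hp, rfl⟩
    have : Fact p.Prime := ⟨hp⟩
    have h1 := hP (ZMod p)
    rw [hf.jordanCount_eq, hF, ZMod.card] at h1
    simpa using h1.symm
  have hRS : R = S := eq_of_X_pow_mul_X_sub_one_pow_mul_eq hR0 hR1 hS.eval_zero_pos.ne'
    hS.eval_one_pos.ne' (hfac.symm.trans hPS)
  rw [hRS, natDegree_eq_of_le_of_coeff_ne_zero hS.natDegree_le hS.coeff_pos.ne',
    hE.degree_eq hf.isColumnSeq hf.first_le fun k hk => hf.dualPart_eq_zero (Nat.lt_succ_of_le hk)]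
  congr 1
  · refine Finset.sum_congr rfl fun i hi => ?_
    rw [Nat.sub_add_cancel (Finset.mem_Icc.1 hi).1]
  · refine Finset.sum_congr rfl fun i hi => ?_
    rw [Nat.sub_add_cancel (by have := (Finset.mem_Icc.1 hi).1; omega)]
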